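/- arXiv:1605.05571 — 2 statements merged into one kernel-verified Lean document; each statement's English description precedes it below -/
import Mathlib

section
/- Let Π be a partition of {1,…,n}. (i) If δ_n ∉ S_Π, then Comp_{n+1}(S_Π) = S_{Π'}. (ii) If δ_n ∈ S_Π, then Comp_{n+1}(S_Π) = S_{Π'} ∪ δ_{n+1}S_{Π'} = ⟨S_{Π'}, δ_{n+1}⟩, and moreover Π' = δ_{n+1}(Π'). -/
/-- `τ` is an `ℓ`-pattern of `π`: there is a strictly increasing map `f` such that
`τ i < τ j ↔ π (f i) < π (f j)` for all `i, j`. -/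
def IsPattern {l n : ℕ} (τ : Equiv.Perm (Fin l)) (π : Equiv.Perm (Fin n)) : Prop :=
  ∃ f : Fin l → Fin n, StrictMono f ∧ ∀ i j : Fin l, τ i < τ j ↔ π (f i) < π (f j)

/-- `Comp_n(S)`: permutations of degree `n` all of whose `ℓ`-patterns lie in `S`. -/
def Compn (n : ℕ) {l : ℕ} (S : Set (Equiv.Perm (Fin l))) : Set (Equiv.Perm (Fin n)) :=
  {π | ∀ τ : Equiv.Perm (Fin l), IsPattern τ π → τ ∈ S}

/-- The descending permutation `δ_n : i ↦ n + 1 - i` (zero-based: `i ↦ n - 1 - i`). -/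
def descPerm (n : ℕ) : Equiv.Perm (Fin n) :=
  Function.Involutive.toPerm Fin.rev fun i => Fin.rev_rev i

/-- `S_Π`: the set of permutations mapping every block of `P` onto itself. -/
def SPiSet {n : ℕ} (P : Set (Set (Fin n))) : Set (Equiv.Perm (Fin n)) :=
  {π | ∀ B ∈ P, π '' B = B}

/-- `x` and `y` lie in a common block of `P`. -/
def SameBlock {n : ℕ} (P : Set (Set (Fin n))) (x y : Fin n) : Prop :=
  ∃ B ∈ P, x ∈ B ∧ y ∈ B

/-- `i` and `j` lie in the same block of the coarsest interval partition refining `P`: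
every pair of consecutive elements between them lies in a common `P`-block. -/
def IntervalRel {n : ℕ} (P : Set (Set (Fin n))) (i j : Fin n) : Prop :=
  ∀ k : ℕ, min (i : ℕ) (j : ℕ) ≤ k → k + 1 ≤ max (i : ℕ) (j : ℕ) →
    ∀ (hk : k < n) (hk1 : k + 1 < n), SameBlock P ⟨k, hk⟩ ⟨k + 1, hk1⟩

/-- `I(P)`: the coarsest interval partition of `{0, …, n-1}` refining `P`,
given as the set of equivalence classes of `IntervalRel P`. -/
def maxIntervals {n : ℕ} (P : Set (Set (Fin n))) : Set (Set (Fin n)) :=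
  {C | ∃ i : Fin n, C = {j | IntervalRel P i j}}

/-- The (zero-based) interval `[a, b]` inside `Fin n`. -/
def finInterval (n a b : ℕ) : Set (Fin n) := {j | a ≤ (j : ℕ) ∧ (j : ℕ) ≤ b}

/-- The partition `Π'` of `{0, …, n}` obtained blockwise from `I(P)`:
for each block `[a, b]` of `I(P)` (zero-based, so `b = n - 1` means the block reaches the
right end), (1) if `a = 0` and `b < n - 1` then `[0, b]` is a block of `Π'`;
(2) if `a > 0` and `b < n - 1` then `{a}` is a block of `Π'` and, when `a < b`, so is
`[a+1, b]`; (3) if `a > 0` and `b = n - 1` then `{a}` and `[a+1, n]` are blocks of `Π'`;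
(4) if `a = 0` and `b = n - 1` then `[0, n]` is a block of `Π'`. -/
def PiPrime {n : ℕ} (P : Set (Set (Fin n))) : Set (Set (Fin (n + 1))) :=
  {C | ∃ a b : ℕ, a ≤ b ∧ b < n ∧ finInterval n a b ∈ maxIntervals P ∧
    ((a = 0 ∧ b + 1 < n ∧ C = finInterval (n + 1) 0 b) ∨
     (0 < a ∧ b + 1 < n ∧
       (C = finInterval (n + 1) a a ∨ (a < b ∧ C = finInterval (n + 1) (a + 1) b))) ∨
     (0 < a ∧ b + 1 = n ∧
       (C = finInterval (n + 1) a a ∨ C = finInterval (n + 1) (a + 1) n)) ∨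
     (a = 0 ∧ b + 1 = n ∧ C = finInterval (n + 1) 0 n))}

/-- The block of `P` containing `k`, as a colouring of the natural numbers (empty for `n ≤ k`). -/
def blockAt {n : ℕ} (P : Set (Set (Fin n))) (k : ℕ) : Set (Fin n) :=
  {y | ∃ h : k < n, SameBlock P ⟨k, h⟩ y}

/-- `g` is the left end of a block of `I(P)` other than the leftmost one. -/
def IsStart {n : ℕ} (P : Set (Set (Fin n))) (g : ℕ) : Prop :=
  0 < g ∧ g < n ∧ blockAt P (g - 1) ≠ blockAt P g

/-- `i` and `j` are in the same position relative to every start; this is the equivalence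
relation of `PiPrime P`. -/
def StartRel {n : ℕ} (P : Set (Set (Fin n))) (i j : ℕ) : Prop :=
  ∀ g, IsStart P g → (i < g ↔ j < g) ∧ (g < i ↔ g < j)

/-- The position of `x` after `p` has been deleted. -/
def dropPos (x p : ℕ) : ℕ := if p < x then x - 1 else x

theorem descPerm_val {n : ℕ} (i : Fin n) : (descPerm n i : ℕ) = n - (i + 1) :=
  Fin.val_rev i

theorem descPerm_descPerm {n : ℕ} (i : Fin n) : descPerm n (descPerm n i) = i :=
  Fin.rev_rev i

theorem descPerm_mul_self (n : ℕ) : descPerm n * descPerm n = 1 :=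
  Equiv.ext fun i => descPerm_descPerm i

theorem sameBlock_iff_blockAt {n : ℕ} {P : Set (Set (Fin n))} (hP : Setoid.IsPartition P)
    (x y : Fin n) : SameBlock P x y ↔ blockAt P x = blockAt P y := by
  have uniq : ∀ {z : Fin n} {B C : Set (Fin n)}, B ∈ P → C ∈ P → z ∈ B → z ∈ C → B = C :=
    fun hB hC hzB hzC => (hP.2 _).unique ⟨hB, hzB⟩ ⟨hC, hzC⟩
  constructor
  · rintro ⟨B, hB, hx, hy⟩
    ext z
    constructor
    · rintro ⟨_, C, hC, hxC, hzC⟩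
      exact ⟨y.2, C, hC, uniq hB hC hx hxC ▸ hy, hzC⟩
    · rintro ⟨_, C, hC, hyC, hzC⟩
      exact ⟨x.2, C, hC, uniq hB hC hy hyC ▸ hx, hzC⟩
  · intro h
    obtain ⟨B, ⟨hB, hy⟩, -⟩ := hP.2 y
    have hmem : y ∈ blockAt P y := ⟨y.2, B, hB, hy, hy⟩
    rw [← h] at hmem
    exact hmem.2

theorem image_eq_of_forall_mem_iff {α : Type*} (π : Equiv.Perm α) (B : Set α)
    (h : ∀ i, i ∈ B ↔ π i ∈ B) : π '' B = B := by
  ext y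
  constructor
  · rintro ⟨x, hx, rfl⟩
    exact (h x).1 hx
  · intro hy
    exact ⟨π.symm y, (h _).2 (by simpa using hy), by simp⟩

theorem mem_SPiSet_iff {n : ℕ} {P : Set (Set (Fin n))} (hP : Setoid.IsPartition P)
    (π : Equiv.Perm (Fin n)) :
    π ∈ SPiSet P ↔ ∀ i : Fin n, blockAt P i = blockAt P (π i) := by
  constructor
  · intro h i
    obtain ⟨B, ⟨hB, hi⟩, -⟩ := hP.2 i
    refine (sameBlock_iff_blockAt hP _ _).1 ⟨B, hB, hi, ?_⟩
    rw [← h B hB]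
    exact ⟨i, hi, rfl⟩
  · intro h B hB
    refine image_eq_of_forall_mem_iff π B fun i => ?_
    obtain ⟨C, hC, hi, hπ⟩ := (sameBlock_iff_blockAt hP _ _).2 (h i)
    constructor
    · intro hiB
      exact (hP.2 i).unique ⟨hC, hi⟩ ⟨hB, hiB⟩ ▸ hπ
    · intro hiB
      exact (hP.2 (π i)).unique ⟨hC, hπ⟩ ⟨hB, hiB⟩ ▸ hi

/-! ### Patterns of codegree one -/

theorem dropPos_succAbove {n : ℕ} (p : Fin (n + 1)) (i : Fin n) :
    dropPos (p.succAbove i) p = i := by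
  unfold dropPos
  rcases Fin.castSucc_lt_or_lt_succ p i with h | h
  · rw [Fin.succAbove_of_castSucc_lt p i h]
    simp only [Fin.lt_def, Fin.val_castSucc] at *
    split_ifs <;> omega
  · rw [Fin.succAbove_of_lt_succ p i h]
    simp only [Fin.lt_def, Fin.val_succ] at *
    split_ifs
    omega

theorem StrictMono.eq_succAbove {n : ℕ} {f : Fin n → Fin (n + 1)} (hf : StrictMono f)
    {p : Fin (n + 1)} (hp : ∀ i, f i ≠ p) : f = p.succAbove := by
  refine (hf.range_inj (Fin.strictMono_succAbove p)).1 ?_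
  rw [Fin.range_succAbove]
  refine Set.eq_of_subset_of_ncard_le ?_ ?_
  · rintro _ ⟨i, rfl⟩
    exact hp i
  · rw [Set.ncard_compl, Set.ncard_singleton, ← Set.image_univ,
      Set.ncard_image_of_injective _ hf.injective]
    simp

theorem exists_forall_ne {n : ℕ} (f : Fin n → Fin (n + 1)) : ∃ p, ∀ i, f i ≠ p := by
  by_contra! h
  have := Fintype.card_le_of_surjective f h
  simp at this

theorem pattern_val {n : ℕ} {τ : Equiv.Perm (Fin n)} {π : Equiv.Perm (Fin (n + 1))}
    {f : Fin n → Fin (n + 1)} (hτ : ∀ i j, τ i < τ j ↔ π (f i) < π (f j))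
    {p : Fin (n + 1)} (hp : ∀ i, f i ≠ p) (i : Fin n) :
    (τ i : ℕ) = dropPos (π (f i)) (π p) := by
  have hmono : StrictMono fun k => π (f (τ.symm k)) := fun a b hab =>
    (hτ _ _).1 (by simpa using hab)
  have := congrFun (hmono.eq_succAbove (p := π p) fun k => by simpa using hp _) (τ i)
  simp only [Equiv.symm_apply_apply] at this
  rw [this, dropPos_succAbove]

theorem mem_Compn_iff {n : ℕ} {P : Set (Set (Fin n))} (hP : Setoid.IsPartition P)
    (π : Equiv.Perm (Fin (n + 1))) :
    π ∈ Compn (n + 1) (SPiSet P) ↔ ∀ x p : Fin (n + 1), x ≠ p →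
      blockAt P (dropPos x p) = blockAt P (dropPos (π x) (π p)) := by
  constructor
  · intro h x p hxp
    let τ : Equiv.Perm (Fin n) := (finSuccAboveEquiv p).trans
      ((π.subtypeEquiv fun a => (π.injective.ne_iff (x := a) (y := p)).symm).trans
        (finSuccAboveEquiv (π p)).symm)
    have hval : ∀ i, (π p).succAbove (τ i) = π (p.succAbove i) := fun i => by
      have := congrArg Subtype.val ((finSuccAboveEquiv (π p)).apply_symm_apply
        (π.subtypeEquiv (fun a => (π.injective.ne_iff (x := a) (y := p)).symm)
          (finSuccAboveEquiv p i)))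
      exact this
    have hτ : ∀ i j, τ i < τ j ↔ π (p.succAbove i) < π (p.succAbove j) := fun i j => by
      rw [← hval, ← hval, (Fin.strictMono_succAbove (π p)).lt_iff_lt]
    have hmem := (mem_SPiSet_iff hP τ).1
      (h τ ⟨p.succAbove, Fin.strictMono_succAbove p, hτ⟩)
    obtain ⟨i, rfl⟩ := Fin.exists_succAbove_eq hxp
    have := hmem i
    rwa [pattern_val hτ (Fin.succAbove_ne p) i, ← dropPos_succAbove p i] at this
  · rintro h τ ⟨f, hf, hτ⟩
    obtain ⟨p, hp⟩ := exists_forall_ne f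
    refine (mem_SPiSet_iff hP τ).2 fun i => ?_
    have := h (f i) p (hp i)
    rwa [← pattern_val hτ hp i, hf.eq_succAbove hp, dropPos_succAbove] at this

/-! ### Starts and the blocks of `PiPrime P` -/

theorem blockAt_eq_of_no_start {n : ℕ} {P : Set (Set (Fin n))} {u v : ℕ} (huv : u ≤ v)
    (hv : v < n) (h : ∀ g, IsStart P g → ¬ (u < g ∧ g ≤ v)) : blockAt P u = blockAt P v := by
  induction v, huv using Nat.le_induction with
  | base => rfl
  | succ v huv ih =>
    rw [ih (by omega) fun g hg hgv => h g hg ⟨hgv.1, by omega⟩]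
    by_contra hne
    exact h (v + 1) ⟨by omega, hv, hne⟩ ⟨by omega, le_rfl⟩

theorem intervalRel_iff {n : ℕ} {P : Set (Set (Fin n))} (hP : Setoid.IsPartition P)
    (i j : Fin n) :
    IntervalRel P i j ↔ ∀ g, IsStart P g → ¬ (min (i : ℕ) j < g ∧ g ≤ max (i : ℕ) j) := by
  constructor
  · rintro h g ⟨hg, hgn, hne⟩ ⟨h1, h2⟩
    have := (sameBlock_iff_blockAt hP _ _).1
      (h (g - 1) (by omega) (by omega) (by omega) (by omega))
    simp only [Nat.sub_add_cancel hg] at this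
    exact hne this
  · intro h k hk1 hk2 hk hk'
    rw [sameBlock_iff_blockAt hP]
    by_contra hne
    exact h (k + 1) ⟨by omega, hk', hne⟩ ⟨by omega, hk2⟩

theorem finInterval_mem_maxIntervals_iff {n : ℕ} {P : Set (Set (Fin n))}
    (hP : Setoid.IsPartition P) {a b : ℕ} (hab : a ≤ b) (hb : b < n) :
    finInterval n a b ∈ maxIntervals P ↔
      (a = 0 ∨ IsStart P a) ∧ (b + 1 = n ∨ IsStart P (b + 1)) ∧
        ∀ g, IsStart P g → ¬ (a < g ∧ g ≤ b) := by
  constructor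
  · rintro ⟨i, hi⟩
    have key : ∀ j : Fin n, (a ≤ (j : ℕ) ∧ (j : ℕ) ≤ b) ↔
        ∀ g, IsStart P g → ¬ (min (i : ℕ) j < g ∧ g ≤ max (i : ℕ) j) := fun j => by
      rw [← intervalRel_iff hP]
      exact Set.ext_iff.1 hi j
    have hii := (key i).2 fun g _ => by omega
    have hka := (key ⟨a, by omega⟩).1 (by simpa using hab)
    have hkb := (key ⟨b, hb⟩).1 (by simpa using hab)
    simp only at hka hkb
    refine ⟨?_, ?_, fun g hg hgab => ?_⟩
    · by_contra! hna
      have := (key ⟨a - 1, by omega⟩).2 fun g hg hlt => ?_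
      · simp only at this
        omega
      · simp only at hlt
        have hga : g ≠ a := fun h => hna.2 (h ▸ hg)
        exact hka g hg (by omega)
    · by_contra! hnb
      have := (key ⟨b + 1, by omega⟩).2 fun g hg hlt => ?_
      · simp only at this
        omega
      · simp only at hlt
        have hga : g ≠ b + 1 := fun h => hnb.2 (h ▸ hg)
        exact hkb g hg (by omega)
    · have h1 := hka g hg
      have h2 := hkb g hg
      omega
  · rintro ⟨ha, hb', hno⟩
    refine ⟨⟨a, by omega⟩, Set.ext fun j => ?_⟩
    change (a ≤ (j : ℕ) ∧ (j : ℕ) ≤ b) ↔ IntervalRel P ⟨a, by omega⟩ j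
    rw [intervalRel_iff hP]
    simp only
    constructor
    · intro hj g hg
      have := hno g hg
      omega
    · intro h
      constructor
      · rcases ha with rfl | ha
        · omega
        · have := h a ha
          omega
      · rcases hb' with hb' | hb'
        · omega
        · have := h _ hb'
          omega

theorem exists_interval_around {n : ℕ} (P : Set (Set (Fin n))) {m : ℕ} (hm : m < n) :
    ∃ a b, a ≤ m ∧ m ≤ b ∧ b < n ∧ (a = 0 ∨ IsStart P a) ∧ (b + 1 = n ∨ IsStart P (b + 1)) ∧
      ∀ g, IsStart P g → ¬ (a < g ∧ g ≤ b) := by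
  classical
  have hex : ∃ d, m + d + 1 = n ∨ IsStart P (m + d + 1) := ⟨n - 1 - m, by omega⟩
  have hex' : ∃ d, m - d = 0 ∨ IsStart P (m - d) := ⟨m, by omega⟩
  have hd := Nat.find_spec hex
  have he := Nat.find_spec hex'
  have hdmin := fun k => Nat.find_min (m := k) hex
  have hemin := fun k => Nat.find_min (m := k) hex'
  have hdle : Nat.find hex ≤ n - 1 - m := Nat.find_min' hex (by omega)
  generalize Nat.find hex = d at *
  generalize Nat.find hex' = e at *
  refine ⟨m - e, m + d, by omega, by omega, by omega, he, hd, fun g hg hgab => ?_⟩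
  rcases le_or_gt g m with hgm | hgm
  · refine hemin (m - g) (by omega) (Or.inr ?_)
    rwa [Nat.sub_sub_self hgm]
  · refine hdmin (g - m - 1) (by omega) (Or.inr ?_)
    rwa [show m + (g - m - 1) + 1 = g by omega]

/-- Each of the intervals that `PiPrime P` contains on account of the block `[a, b]` of `I(P)`
is the `StartRel`-class of any of its elements. -/
theorem finInterval_eq_startRel {n : ℕ} {P : Set (Set (Fin n))} {a b e f i : ℕ}
    (hab : a ≤ b) (ha : a = 0 ∨ IsStart P a) (hb' : b + 1 = n ∨ IsStart P (b + 1))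
    (hno : ∀ g, IsStart P g → ¬ (a < g ∧ g ≤ b))
    (hef : (e = a ∧ f = a ∧ i = a ∧ 0 < a) ∨
      ((e = 0 ∧ a = 0 ∨ e = a + 1 ∧ 0 < a) ∧ e ≤ i ∧ i ≤ f ∧
        (f = b ∧ b + 1 < n ∨ f = n ∧ b + 1 = n))) :
    finInterval (n + 1) e f = {j : Fin (n + 1) | StartRel P i j} := by
  ext j
  change (e ≤ (j : ℕ) ∧ (j : ℕ) ≤ f) ↔ StartRel P i j
  have hj := j.2
  constructor
  · intro hef' g hg
    have := hno g hg
    have := hg.1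
    have := hg.2.1
    omega
  · intro h
    have h1 := ha.imp_right (h a)
    have h2 := hb'.imp_right (h (b + 1))
    omega

theorem mem_PiPrime_iff {n : ℕ} (hn : 0 < n) {P : Set (Set (Fin n))}
    (hP : Setoid.IsPartition P) (C : Set (Fin (n + 1))) :
    C ∈ PiPrime P ↔ ∃ i : Fin (n + 1), C = {j : Fin (n + 1) | StartRel P i j} := by
  constructor
  · rintro ⟨a, b, hab, hb, hmem, hC⟩
    obtain ⟨ha, hb', hno⟩ := (finInterval_mem_maxIntervals_iff hP hab hb).1 hmem
    have key := fun {e f} (i : Fin (n + 1)) =>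
      finInterval_eq_startRel (e := e) (f := f) (i := i) hab ha hb' hno
    rcases hC with ⟨h0, h1, rfl⟩ | ⟨h0, h1, rfl | ⟨h2, rfl⟩⟩ | ⟨h0, h1, rfl | rfl⟩ |
      ⟨h0, h1, rfl⟩
    · exact ⟨0, key 0 (by simp; omega)⟩
    · exact ⟨⟨a, by omega⟩, key _ (by simp; omega)⟩
    · exact ⟨⟨b, by omega⟩, key _ (by simp; omega)⟩
    · exact ⟨⟨a, by omega⟩, key _ (by simp; omega)⟩
    · exact ⟨⟨n, by omega⟩, key _ (by simp; omega)⟩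
    · exact ⟨0, key 0 (by simp; omega)⟩
  · rintro ⟨i, rfl⟩
    have hi := i.2
    obtain ⟨a, b, ham, hmb, hb, ha, hb', hno⟩ :=
      exists_interval_around P (m := min i (n - 1)) (by omega)
    have hab : a ≤ b := ham.trans hmb
    refine ⟨a, b, hab, hb, (finInterval_mem_maxIntervals_iff hP hab hb).2 ⟨ha, hb', hno⟩, ?_⟩
    have key := fun {e f} => finInterval_eq_startRel (e := e) (f := f) (i := i) hab ha hb' hno
    rcases Nat.eq_zero_or_pos a with h0 | h0 <;>
      rcases (show b + 1 < n ∨ b + 1 = n by omega) with h1 | h1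
    · exact Or.inl ⟨h0, h1, (key (by omega)).symm⟩
    · exact Or.inr (Or.inr (Or.inr ⟨h0, h1, (key (by omega)).symm⟩))
    · refine Or.inr (Or.inl ⟨h0, h1, ?_⟩)
      by_cases hia : (i : ℕ) = a
      · exact Or.inl (key (by omega)).symm
      · exact Or.inr ⟨by omega, (key (by omega)).symm⟩
    · refine Or.inr (Or.inr (Or.inl ⟨h0, h1, ?_⟩))
      by_cases hia : (i : ℕ) = a
      · exact Or.inl (key (by omega)).symm
      · exact Or.inr (key (by omega)).symm

theorem startRel_refl {n : ℕ} (P : Set (Set (Fin n))) (i : ℕ) : StartRel P i i :=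
  fun _ _ => ⟨Iff.rfl, Iff.rfl⟩

theorem mem_SPiSet_PiPrime_iff {n : ℕ} (hn : 0 < n) {P : Set (Set (Fin n))}
    (hP : Setoid.IsPartition P) (π : Equiv.Perm (Fin (n + 1))) :
    π ∈ SPiSet (PiPrime P) ↔ ∀ i : Fin (n + 1), StartRel P i (π i) := by
  constructor
  · intro h i
    have himg := h _ ((mem_PiPrime_iff hn hP _).2 ⟨i, rfl⟩)
    have hmem : π i ∈ π '' {j : Fin (n + 1) | StartRel P i j} := ⟨i, startRel_refl P i, rfl⟩
    rwa [himg] at hmem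
  · intro h B hB
    obtain ⟨k, rfl⟩ := (mem_PiPrime_iff hn hP _).1 hB
    refine image_eq_of_forall_mem_iff π _ fun i => ?_
    refine forall₂_congr fun g hg => ?_
    rw [(h i g hg).1, (h i g hg).2]

/-! ### Compatible permutations near a start -/

theorem startRel_mem_Compn {n : ℕ} {P : Set (Set (Fin n))} (hP : Setoid.IsPartition P)
    {π : Equiv.Perm (Fin (n + 1))} (h : ∀ i : Fin (n + 1), StartRel P i (π i)) :
    π ∈ Compn (n + 1) (SPiSet P) := by
  refine (mem_Compn_iff hP π).2 fun x p hxp => ?_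
  have hne : (x : ℕ) ≠ p := fun e => hxp (Fin.ext e)
  have hne' : (π x : ℕ) ≠ π p := fun e => hxp (π.injective (Fin.ext e))
  have hx := x.2
  have hp := p.2
  have hx' := (π x).2
  have hp' := (π p).2
  have hsep : ∀ g, IsStart P g → (dropPos x p < g ↔ dropPos (π x) (π p) < g) := by
    intro g hg
    have h1 := h x g hg
    have h2 := h p g hg
    unfold dropPos
    split_ifs <;> omega
  have hlt : dropPos x p < n := by
    unfold dropPos
    split_ifs <;> omega
  have hlt' : dropPos (π x) (π p) < n := by
    unfold dropPos
    split_ifs <;> omega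
  rcases le_total (dropPos x p) (dropPos (π x) (π p)) with hle | hle
  · refine blockAt_eq_of_no_start hle hlt' fun g hg => ?_
    have := hsep g hg
    omega
  · refine (blockAt_eq_of_no_start hle hlt fun g hg => ?_).symm
    have := hsep g hg
    omega

theorem apply_eq_of_forall_lt_iff {n : ℕ} (π : Equiv.Perm (Fin n)) (x : Fin n)
    (h : ∀ p, p < x ↔ π p < π x) : π x = x := by
  have hmap : (Finset.Iio x).map π.toEmbedding = Finset.Iio (π x) := by
    ext y
    simp only [Finset.mem_map_equiv, Finset.mem_Iio, h, Equiv.apply_symm_apply]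
  have := congrArg Finset.card hmap
  rw [Finset.card_map, Fin.card_Iio, Fin.card_Iio] at this
  exact Fin.ext this.symm

/-- At a start, a compatible permutation preserves or swaps both sides, depending on
whether `π 0 < π n`. -/
theorem lt_iff_of_start {n : ℕ} {P : Set (Set (Fin n))} (hP : Setoid.IsPartition P)
    {π : Equiv.Perm (Fin (n + 1))} (hπ : π ∈ Compn (n + 1) (SPiSet P))
    {g : Fin (n + 1)} (hg : IsStart P g) :
    (π 0 < π (Fin.last n) → ∀ p, p < g ↔ π p < π g) ∧
    (π (Fin.last n) < π 0 → ∀ p, p < g ↔ π g < π p) := by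
  rw [mem_Compn_iff hP] at hπ
  obtain ⟨hg0, hgn, hne⟩ := hg
  have hleft : ∀ p, p < g → blockAt P (g - 1) = blockAt P (dropPos (π g) (π p)) := by
    intro p hp
    have := hπ g p hp.ne'
    rwa [dropPos, if_pos (Fin.lt_def.1 hp)] at this
  have hright : ∀ p, g < p → blockAt P g = blockAt P (dropPos (π g) (π p)) := by
    intro p hp
    have := hπ g p hp.ne
    rwa [dropPos, if_neg (Fin.lt_def.1 hp).not_gt] at this
  have hsame : ∀ p q, p < g → g < q → (π p < π g ↔ π g < π q) := by
    intro p q hp hq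
    have hpne : π p ≠ π g := π.injective.ne hp.ne
    have hqne : π q ≠ π g := π.injective.ne hq.ne'
    by_contra hcon
    have hdrop : dropPos (π g) (π p) = dropPos (π g) (π q) := by
      unfold dropPos
      split_ifs <;> omega
    exact hne (by rw [hleft p hp, hright q hq, hdrop])
  have h0 : (0 : Fin (n + 1)) < g := Fin.lt_def.2 hg0
  have hl : g < Fin.last n := Fin.lt_def.2 hgn
  have h0l := hsame 0 _ h0 hl
  have hn0 : π 0 ≠ π g := π.injective.ne h0.ne
  have hnl : π (Fin.last n) ≠ π g := π.injective.ne hl.ne'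
  constructor <;> intro hlt p <;> rcases lt_trichotomy p g with hp | rfl | hp
  · have := hsame p _ hp hl
    omega
  · simp
  · have := hsame 0 p h0 hp
    omega
  · have := hsame p _ hp hl
    have : π p ≠ π g := π.injective.ne hp.ne
    omega
  · simp
  · have := hsame 0 p h0 hp
    have : π p ≠ π g := π.injective.ne hp.ne'
    omega

theorem startRel_of_forall_lt_iff {n : ℕ} {P : Set (Set (Fin n))}
    {π : Equiv.Perm (Fin (n + 1))}
    (h : ∀ g : Fin (n + 1), IsStart P g → ∀ p, p < g ↔ π p < π g) (i : Fin (n + 1)) :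
    StartRel P i (π i) := by
  intro g hg
  have hgn : g < n + 1 := by have := hg.2.1; omega
  have hlt := h ⟨g, hgn⟩ hg
  have hfix := apply_eq_of_forall_lt_iff π _ hlt
  have hi := hlt i
  have hinj : i = ⟨g, hgn⟩ ↔ π i = ⟨g, hgn⟩ := by
    conv_rhs => rw [← hfix]
    exact π.injective.eq_iff.symm
  rw [hfix] at hi
  simp only [Fin.lt_def, Fin.ext_iff] at hi hinj
  omega

/-! ### The descending permutation -/

theorem descPerm_mem_iff {n : ℕ} {P : Set (Set (Fin n))} (hP : Setoid.IsPartition P) :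
    descPerm n ∈ SPiSet P ↔ ∀ i < n, blockAt P i = blockAt P (n - 1 - i) := by
  rw [mem_SPiSet_iff hP, Fin.forall_iff]
  refine forall₂_congr fun i hi => ?_
  rw [descPerm_val, Nat.sub_sub, Nat.add_comm 1]

theorem descPerm_succ_mem_Compn {n : ℕ} {P : Set (Set (Fin n))} (hP : Setoid.IsPartition P)
    (hδ : descPerm n ∈ SPiSet P) : descPerm (n + 1) ∈ Compn (n + 1) (SPiSet P) := by
  refine (mem_Compn_iff hP _).2 fun x p hxp => ?_
  have hne : (x : ℕ) ≠ p := fun e => hxp (Fin.ext e)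
  have hx := x.2
  have hp := p.2
  rw [descPerm_val, descPerm_val, (descPerm_mem_iff hP).1 hδ]
  · congr 1
    unfold dropPos
    split_ifs <;> omega
  · unfold dropPos
    split_ifs <;> omega

theorem IsStart.symm {n : ℕ} {P : Set (Set (Fin n))} (hP : Setoid.IsPartition P)
    (hδ : descPerm n ∈ SPiSet P) {g : ℕ} (hg : IsStart P g) : IsStart P (n - g) := by
  obtain ⟨h0, hn, hne⟩ := hg
  rw [descPerm_mem_iff hP] at hδ
  refine ⟨by omega, by omega, fun h => hne ?_⟩
  rw [hδ _ hn, hδ (g - 1) (by omega), show n - 1 - (g - 1) = n - g by omega, ← h]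
  congr 1
  omega

theorem StartRel.desc {n : ℕ} {P : Set (Set (Fin n))} (hP : Setoid.IsPartition P)
    (hδ : descPerm n ∈ SPiSet P) {i j : Fin (n + 1)} (h : StartRel P i j) :
    StartRel P (descPerm (n + 1) i) (descPerm (n + 1) j) := by
  intro g hg
  have := h _ (hg.symm hP hδ)
  have := hg.2.1
  rw [descPerm_val, descPerm_val]
  omega

/-- The subgroup of permutations all of whose patterns lie in `S_Π`. -/
def compSubgroup {n : ℕ} {P : Set (Set (Fin n))} (hP : Setoid.IsPartition P) :
    Subgroup (Equiv.Perm (Fin (n + 1))) where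
  carrier := Compn (n + 1) (SPiSet P)
  one_mem' := (mem_Compn_iff hP _).2 fun _ _ _ => rfl
  mul_mem' {σ ρ} hσ hρ := (mem_Compn_iff hP _).2 fun x p hxp =>
    ((mem_Compn_iff hP _).1 hρ x p hxp).trans
      ((mem_Compn_iff hP _).1 hσ _ _ (ρ.injective.ne hxp))
  inv_mem' {σ} hσ := (mem_Compn_iff hP _).2 fun x p hxp => by
    simpa using ((mem_Compn_iff hP _).1 hσ _ _ (σ⁻¹.injective.ne hxp)).symm

/-- A compatible permutation either respects the starts, or reverses them; in the latter case
the descending permutation lies in `S_Π`. -/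
theorem mem_Compn_cases {n : ℕ} (hn : 0 < n) {P : Set (Set (Fin n))}
    (hP : Setoid.IsPartition P) {π : Equiv.Perm (Fin (n + 1))}
    (hπ : π ∈ Compn (n + 1) (SPiSet P)) :
    (∀ i : Fin (n + 1), StartRel P i (π i)) ∨
      descPerm n ∈ SPiSet P ∧ ∀ i : Fin (n + 1), StartRel P i (descPerm (n + 1) (π i)) := by
  have h0l : (0 : Fin (n + 1)) ≠ Fin.last n := (Fin.lt_def.2 hn).ne
  rcases lt_or_gt_of_ne (π.injective.ne h0l) with hlt | hlt
  · exact Or.inl (startRel_of_forall_lt_iff fun g hg => (lt_iff_of_start hP hπ hg).1 hlt)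
  by_cases hs : ∃ g, IsStart P g
  swap
  · exact Or.inl fun i g hg => (hs ⟨g, hg⟩).elim
  have hrev : ∀ g : Fin (n + 1), IsStart P g → ∀ p,
      p < g ↔ (descPerm (n + 1) * π) p < (descPerm (n + 1) * π) g := by
    intro g hg p
    rw [(lt_iff_of_start hP hπ hg).2 hlt p]
    exact Fin.rev_lt_rev.symm
  refine Or.inr ⟨(descPerm_mem_iff hP).2 ?_, startRel_of_forall_lt_iff hrev⟩
  have hval : ∀ g, IsStart P g → ∃ h : g < n + 1, (π ⟨g, h⟩ : ℕ) = n - g := by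
    intro g hg
    have hgn : g < n + 1 := by have := hg.2.1; omega
    refine ⟨hgn, ?_⟩
    have := congrArg Fin.val (apply_eq_of_forall_lt_iff _ _ (hrev ⟨g, hgn⟩ hg))
    rw [Equiv.Perm.mul_apply, descPerm_val] at this
    simp only at this
    omega
  have hmem := (mem_Compn_iff hP π).1 hπ
  have hpair : ∀ g, IsStart P g → blockAt P (g - 1) = blockAt P (n - g) ∧
      blockAt P g = blockAt P (n - 1 - g) := by
    intro g hg
    obtain ⟨hgn, hv⟩ := hval g hg
    have hiff := (lt_iff_of_start hP hπ (g := ⟨g, hgn⟩) hg).2 hlt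
    have hg0 := hg.1
    have hgn' := hg.2.1
    have hz : (0 : Fin (n + 1)) < ⟨g, hgn⟩ := Fin.lt_def.2 hg0
    have hl : ⟨g, hgn⟩ < Fin.last n := Fin.lt_def.2 hgn'
    have h1 := hmem ⟨g, hgn⟩ 0 hz.ne'
    have h2 := hmem ⟨g, hgn⟩ (Fin.last n) hl.ne
    have hπ0 : π ⟨g, hgn⟩ < π 0 := (hiff 0).1 hz
    have hπl : π (Fin.last n) < π ⟨g, hgn⟩ :=
      lt_of_le_of_ne (not_lt.1 fun h => hl.not_gt ((hiff _).2 h)) (π.injective.ne hl.ne')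
    rw [dropPos, dropPos, if_pos (Fin.lt_def.1 hz), if_neg (Fin.lt_def.1 hπ0).not_gt, hv] at h1
    rw [dropPos, dropPos, if_neg (Fin.lt_def.1 hl).not_gt, if_pos (Fin.lt_def.1 hπl), hv,
      Nat.sub_right_comm] at h2
    exact ⟨h1, h2⟩
  have hsymm : ∀ g, IsStart P g → IsStart P (n - g) := by
    intro g hg
    obtain ⟨h1, h2⟩ := hpair g hg
    obtain ⟨hg0, hgn, hne⟩ := hg
    refine ⟨by omega, by omega, fun h => hne ?_⟩
    rw [h1, h2, ← h, Nat.sub_right_comm]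
  have hstep : ∀ i, i + 1 < n → (blockAt P i = blockAt P (n - 1 - i) ↔
      blockAt P (i + 1) = blockAt P (n - 1 - (i + 1))) := by
    intro i hi
    by_cases hst : IsStart P (i + 1)
    · obtain ⟨h1, h2⟩ := hpair _ hst
      rw [Nat.add_sub_cancel, show n - (i + 1) = n - 1 - i by omega] at h1
      exact iff_of_true h1 h2
    · have h1 : blockAt P i = blockAt P (i + 1) := by
        by_contra hne
        exact hst ⟨by omega, hi, hne⟩
      have h2 : blockAt P (n - 1 - (i + 1)) = blockAt P (n - 1 - i) := by
        by_contra hne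
        refine hst ?_
        have := hsymm (n - (i + 1)) ⟨by omega, by omega, ?_⟩
        · rwa [Nat.sub_sub_self hi.le] at this
        · rwa [show n - (i + 1) - 1 = n - 1 - (i + 1) by omega,
            show n - (i + 1) = n - 1 - i by omega]
      rw [h1, h2]
  have hall : ∀ i < n, (blockAt P 0 = blockAt P (n - 1 - 0) ↔
      blockAt P i = blockAt P (n - 1 - i)) := by
    intro i
    induction i with
    | zero => exact fun _ => Iff.rfl
    | succ i ih => exact fun hi => (ih (by omega)).trans (hstep i hi)
  obtain ⟨g, hg⟩ := hs
  exact fun i hi => (hall i hi).1 ((hall g hg.2.1).2 (hpair g hg).2)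

theorem comp_SPi {n : ℕ} (hn : 0 < n) (P : Set (Set (Fin n)))
    (hP : Setoid.IsPartition P) :
    (descPerm n ∉ SPiSet P →
      Compn (n + 1) (SPiSet P) = SPiSet (PiPrime P)) ∧
    (descPerm n ∈ SPiSet P →
      Compn (n + 1) (SPiSet P) =
        SPiSet (PiPrime P) ∪ (fun σ => descPerm (n + 1) * σ) '' SPiSet (PiPrime P) ∧
      Compn (n + 1) (SPiSet P) =
        (Subgroup.closure (SPiSet (PiPrime P) ∪ {descPerm (n + 1)}) :
          Set (Equiv.Perm (Fin (n + 1)))) ∧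
      (fun B => descPerm (n + 1) '' B) '' PiPrime P = PiPrime P) := by
  have hδmul : ∀ σ : Equiv.Perm (Fin (n + 1)), descPerm (n + 1) * (descPerm (n + 1) * σ) = σ :=
    fun σ => by rw [← mul_assoc, descPerm_mul_self, one_mul]
  have hsub : SPiSet (PiPrime P) ⊆ Compn (n + 1) (SPiSet P) := fun π h =>
    startRel_mem_Compn hP ((mem_SPiSet_PiPrime_iff hn hP π).1 h)
  refine ⟨fun hδ => Set.Subset.antisymm (fun π hπ => ?_) hsub, fun hδ => ?_⟩
  · rcases mem_Compn_cases hn hP hπ with h | h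
    · exact (mem_SPiSet_PiPrime_iff hn hP π).2 h
    · exact (hδ h.1).elim
  have hδ' := descPerm_succ_mem_Compn hP hδ
  have hunion : Compn (n + 1) (SPiSet P) =
      SPiSet (PiPrime P) ∪ (fun σ => descPerm (n + 1) * σ) '' SPiSet (PiPrime P) := by
    refine Set.Subset.antisymm (fun π hπ => ?_) (Set.union_subset hsub ?_)
    · rcases mem_Compn_cases hn hP hπ with h | h
      · exact Or.inl ((mem_SPiSet_PiPrime_iff hn hP π).2 h)
      · exact Or.inr ⟨descPerm (n + 1) * π,
          (mem_SPiSet_PiPrime_iff hn hP _).2 h.2, hδmul π⟩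
    · rintro _ ⟨σ, hσ, rfl⟩
      exact (compSubgroup hP).mul_mem hδ' (hsub hσ)
  refine ⟨hunion, Set.Subset.antisymm ?_ ?_, ?_⟩
  · rw [hunion]
    refine Set.union_subset (fun σ hσ => Subgroup.subset_closure (Or.inl hσ)) ?_
    rintro _ ⟨σ, hσ, rfl⟩
    exact Subgroup.mul_mem _ (Subgroup.subset_closure (Or.inr rfl))
      (Subgroup.subset_closure (Or.inl hσ))
  · exact (Subgroup.closure_le (compSubgroup hP)).2
      (Set.union_subset hsub (Set.singleton_subset_iff.2 hδ'))
  · have himage : ∀ i : Fin (n + 1), descPerm (n + 1) '' {j : Fin (n + 1) | StartRel P i j} =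
        {j : Fin (n + 1) | StartRel P (descPerm (n + 1) i) j} := by
      intro i
      ext y
      constructor
      · rintro ⟨j, hj, rfl⟩
        exact StartRel.desc hP hδ hj
      · intro hy
        refine ⟨descPerm (n + 1) y, ?_, descPerm_descPerm y⟩
        have := StartRel.desc hP hδ hy
        rwa [descPerm_descPerm] at this
    ext C
    constructor
    · rintro ⟨B, hB, rfl⟩
      obtain ⟨i, rfl⟩ := (mem_PiPrime_iff hn hP B).1 hB
      exact (mem_PiPrime_iff hn hP _).2 ⟨_, himage i⟩
    · intro hC
      obtain ⟨i, rfl⟩ := (mem_PiPrime_iff hn hP C).1 hC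
      refine ⟨_, (mem_PiPrime_iff hn hP _).2 ⟨descPerm (n + 1) i, rfl⟩, ?_⟩
      simp only [himage, descPerm_descPerm]
end

section
/- Let G be a subgroup of the symmetric group S_n. If ζ_n ∈ G and Comp_{n+1}(G) is not contained in D_{n+1}, then A_n ≤ G. -/
/-- The natural dihedral group `D_k = ⟨ζ_k, δ_k⟩`. -/
def naturalDihedral (k : ℕ) : Subgroup (Equiv.Perm (Fin k)) :=
  Subgroup.closure {finRotate k, descPerm k}

open Equiv in
/-- If the only point moved by both `g` and `h` is `p`, then their commutator is a 3-cycle. -/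
theorem isThreeCycle_commutator_of_unique_common_moved {α : Type*} [Fintype α] [DecidableEq α]
    {g h : Perm α} {p : α} (hg : g p ≠ p) (hh : h p ≠ p)
    (hgh : ∀ y, y ≠ p → g y = y ∨ h y = y) : (g * h * g⁻¹ * h⁻¹).IsThreeCycle := by
  have hhgp : h (g p) = g p := (hgh _ hg).resolve_left fun e => hg (g.injective e)
  have hghp : g (h p) = h p := (hgh _ hh).resolve_right fun e => hh (h.injective e)
  have hne : h p ≠ g p := fun e => hh (h.injective (by rw [e, hhgp, ← e]))
  have key : g * h = (swap p (h p) * swap p (g p)) * (h * g) := by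
    ext y
    simp only [Perm.mul_apply]
    by_cases hy : y = p
    · subst hy
      rw [hhgp, swap_apply_right, swap_apply_left, hghp]
    rcases hgh y hy with e | e
    · rw [e]
      have h₁ : h y ≠ h p := fun e' => hy (h.injective e')
      have h₂ : h y ≠ g p := fun e' => by
        have : y = g p := h.injective (e'.trans hhgp.symm)
        rw [this] at e
        exact hg (g.injective e)
      by_cases h₃ : h y = p
      · rw [h₃, swap_apply_left, swap_apply_of_ne_of_ne hg hne.symm]
      · rw [swap_apply_of_ne_of_ne h₃ h₂, swap_apply_of_ne_of_ne h₃ h₁]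
        rcases hgh _ h₃ with e' | e'
        · exact e'
        · rw [h.injective e', e]
    · rw [e]
      have h₁ : g y ≠ g p := fun e' => hy (g.injective e')
      by_cases h₃ : g y = p
      · rw [h₃, swap_apply_of_ne_of_ne hh hne, swap_apply_right]
      · rcases hgh _ h₃ with e' | e'
        · have := g.injective e'
          rw [this, e, swap_apply_of_ne_of_ne hy (by rwa [this] at h₁), swap_apply_of_ne_of_ne hy]
          intro e''
          rw [e''] at e
          exact hh (h.injective e)
        · rw [e', swap_apply_of_ne_of_ne h₃ h₁, swap_apply_of_ne_of_ne h₃]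
          intro e''
          rw [e''] at e'
          exact hh (h.injective e')
  have : g * h * g⁻¹ * h⁻¹ = swap p (h p) * swap p (g p) := by
    rw [key]
    group
  rw [this]
  exact Perm.isThreeCycle_swap_mul_swap_same hh.symm hg.symm hne

open Equiv MulAction Pointwise in
/-- A group containing a transitive cycle `ζ` together with a permutation that, away from one
point `p`, either fixes a point or agrees with `ζ` on it, contains the alternating group. -/
theorem alternatingGroup_le_of_fix_or_eq_cycle {α : Type*} [Fintype α] [DecidableEq α]
    (G : Subgroup (Perm α)) {ζ σ : Perm α} (hζ : ζ ∈ G) (hσ : σ ∈ G)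
    (htrans : ∀ x y, ζ.SameCycle x y) {p : α} (hp : σ p ≠ p) (hpζ : σ p ≠ ζ p)
    (h : ∀ y, y ≠ p → σ y = y ∨ σ y = ζ y) : alternatingGroup α ≤ G := by
  set η : Perm α := σ⁻¹ * ζ with hη_def
  have hη : η ∈ G := G.mul_mem (G.inv_mem hσ) hζ
  have hηp : η p ≠ p := fun e => hpζ (by
    rw [hη_def, Perm.mul_apply, Perm.inv_eq_iff_eq] at e
    exact e.symm)
  have hση : ∀ y, y ≠ p → σ y = y ∨ η y = y := fun y hy =>
    (h y hy).imp id fun e => by rw [hη_def, Perm.mul_apply, ← e, Perm.inv_def, symm_apply_apply]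
  have hpre : IsPretransitive G α := ⟨fun x y => by
    obtain ⟨i, hi⟩ := htrans x y
    exact ⟨⟨ζ ^ i, G.zpow_mem hζ i⟩, hi⟩⟩
  have hprim : IsPreprimitive G α := by
    refine IsPreprimitive.of_isTrivialBlock_base p fun {B} hpB hB => ?_
    have stable : ∀ g ∈ G, (∃ a ∈ B, g a = a) → ∀ b ∈ B, g b ∈ B := by
      rintro g hg ⟨a, ha, e⟩ b hb
      have : (⟨g, hg⟩ : G) • B = B :=
        isBlock_iff_smul_eq_of_mem.mp hB ha (by change g a ∈ B; rwa [e])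
      rw [← this]
      exact ⟨b, hb, rfl⟩
    by_cases h₁ : ∃ a ∈ B, σ a = a
    · by_cases h₂ : ∃ a ∈ B, η a = a
      · right
        have hζB : Set.MapsTo ζ B B := fun b hb => by
          have : ζ b = σ (η b) := by simp [hη_def]
          rw [this]
          exact stable σ hσ h₁ _ (stable η hη h₂ b hb)
        refine Set.eq_univ_of_forall fun x => ?_
        obtain ⟨i, hi⟩ := (htrans p x).exists_nat_pow_eq
        rw [← hi, Perm.coe_pow]
        exact hζB.iterate i hpB
      · push Not at h₂
        have hq := stable σ hσ h₁ p hpB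
        rcases hση _ hp with e | e
        · exact absurd (σ.injective e) hp
        · exact absurd e (h₂ _ hq)
    · push Not at h₁
      by_cases h₂ : ∃ a ∈ B, η a = a
      · have hq := stable η hη h₂ p hpB
        rcases hση _ hηp with e | e
        · exact absurd e (h₁ _ hq)
        · exact absurd (η.injective e) hηp
      · push Not at h₂
        left
        have : ∀ b ∈ B, b = p := fun b hb => by
          by_contra hne
          exact (hση b hne).elim (h₁ b hb) (h₂ b hb)
        exact fun b hb c hc => (this b hb).trans (this c hc).symm
  exact Perm.alternatingGroup_le_of_isPreprimitive_of_isThreeCycle_mem hprim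
    (isThreeCycle_commutator_of_unique_common_moved hp hηp hση)
    (G.mul_mem (G.mul_mem (G.mul_mem hσ hη) (G.inv_mem hσ)) (G.inv_mem hη))

/-- The pattern of `π` obtained by deleting position `i` and standardizing. -/
def deletePattern {n : ℕ} (π : Equiv.Perm (Fin (n + 1))) (i : Fin (n + 1)) :
    Equiv.Perm (Fin n) :=
  ((finSuccAboveEquiv i).trans
    (π.subtypeEquiv fun _ => π.injective.ne_iff.symm)).trans (finSuccAboveEquiv (π i)).symm

theorem succAbove_deletePattern {n : ℕ} (π : Equiv.Perm (Fin (n + 1))) (i : Fin (n + 1))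
    (k : Fin n) : (π i).succAbove (deletePattern π i k) = π (i.succAbove k) := by
  change ((finSuccAboveEquiv (π i)) ((finSuccAboveEquiv (π i)).symm _)).val = _
  rw [Equiv.apply_symm_apply]
  rfl

theorem isPattern_deletePattern {n : ℕ} (π : Equiv.Perm (Fin (n + 1))) (i : Fin (n + 1)) :
    IsPattern (deletePattern π i) π := by
  refine ⟨i.succAbove, Fin.strictMono_succAbove i, fun j k => ?_⟩
  rw [← succAbove_deletePattern, ← succAbove_deletePattern,
    (Fin.strictMono_succAbove (π i)).lt_iff_lt]

theorem castSucc_succAbove_eq_succ_succAbove {n : ℕ} {i k : Fin n} (h : k ≠ i) :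
    i.castSucc.succAbove k = i.succ.succAbove k := by
  rcases lt_or_gt_of_ne h with h | h
  · rw [Fin.succAbove_castSucc_of_lt _ _ h, Fin.succAbove_succ_of_le _ _ h.le]
  · rw [Fin.succAbove_castSucc_of_le _ _ h.le, Fin.succAbove_succ_of_lt _ _ h]

/-- A permutation `σ` of `Fin n` realizing the identification of `Fin (n + 1) \ {a}` with
`Fin (n + 1) \ {b}` that sends `b` to `a` and fixes the remaining points. -/
def IsHoleSwap {n : ℕ} (σ : Equiv.Perm (Fin n)) (a b : Fin (n + 1)) : Prop :=
  ∀ y, (a.succAbove y = b ∧ b.succAbove (σ y) = a) ∨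
    b.succAbove (σ y) = a.succAbove y

theorem IsHoleSwap.inv {n : ℕ} {σ : Equiv.Perm (Fin n)} {a b : Fin (n + 1)}
    (h : IsHoleSwap σ a b) : IsHoleSwap σ⁻¹ b a := fun y => by
  have := h (σ⁻¹ y)
  rw [Equiv.Perm.inv_def, Equiv.apply_symm_apply] at this
  exact this.imp And.symm Eq.symm

theorem isHoleSwap_deletePattern {n : ℕ} (π : Equiv.Perm (Fin (n + 1))) (i : Fin n) :
    IsHoleSwap (deletePattern π i.succ * (deletePattern π i.castSucc)⁻¹)
      (π i.castSucc) (π i.succ) := fun y => by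
  obtain ⟨k, rfl⟩ := (deletePattern π i.castSucc).surjective y
  rw [Equiv.Perm.mul_apply, Equiv.Perm.inv_def, Equiv.symm_apply_apply, succAbove_deletePattern,
    succAbove_deletePattern]
  by_cases h : k = i
  · subst h
    left
    simp
  · right
    rw [castSucc_succAbove_eq_succ_succAbove h]

theorem alternatingGroup_le_of_isHoleSwap {n : ℕ} (G : Subgroup (Equiv.Perm (Fin n)))
    (hζ : finRotate n ∈ G) {σ : Equiv.Perm (Fin n)} (hσ : σ ∈ G) {a b : Fin (n + 1)}
    (h : IsHoleSwap σ a b) (hab : (a : ℕ) + 2 ≤ b) (hab' : (b : ℕ) < a + n) :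
    alternatingGroup (Fin n) ≤ G := by
  obtain ⟨m, rfl⟩ : ∃ m, n = m + 2 := ⟨n - 2, by omega⟩
  have hval : ∀ y : Fin (m + 2), ((y : ℕ) + 1 = b ∧ (σ y : ℕ) = a) ∨
      ((y : ℕ) + 1 ≠ b ∧ ((σ y : ℕ) = y ∨ (σ y : ℕ) = y + 1)) := by
    intro y
    have := h y
    simp only [Fin.succAbove, Fin.ext_iff, Fin.lt_def] at this
    split_ifs at this <;> simp at * <;> omega
  have hrot : ∀ y : Fin (m + 2), ((y : ℕ) + 1 < m + 2 ∧ (finRotate (m + 2) y : ℕ) = y + 1) ∨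
      ((y : ℕ) + 1 = m + 2 ∧ (finRotate (m + 2) y : ℕ) = 0) := by
    intro y
    rw [coe_finRotate]
    split_ifs with e
    · right; simp [e]
    · left; have := Fin.val_lt_last e; exact ⟨by omega, rfl⟩
  refine alternatingGroup_le_of_fix_or_eq_cycle G hζ hσ (fun x y => ?_)
    (p := ⟨b - 1, by omega⟩) ?_ ?_ ?_
  · exact isCycle_finRotate.sameCycle (Equiv.Perm.mem_support.mp (by simp [support_finRotate]))
      (Equiv.Perm.mem_support.mp (by simp [support_finRotate]))
  · intro e
    have := hval ⟨b - 1, by omega⟩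
    simp only [Fin.ext_iff] at e this
    omega
  · intro e
    have h₁ := hval ⟨b - 1, by omega⟩
    have h₂ := hrot ⟨b - 1, by omega⟩
    simp only [Fin.ext_iff] at e h₁ h₂
    omega
  · intro y hy
    have h₁ := hval y
    have h₂ := hrot y
    have h₃ := (σ y).isLt
    simp only [Fin.ext_iff, ne_eq] at *
    omega

theorem addRight_mem_naturalDihedral {n : ℕ} (c : Fin (n + 1)) :
    Equiv.addRight c ∈ naturalDihedral (n + 1) := by
  induction c using Fin.induction with
  | zero => simp
  | succ i ih =>
    have : Equiv.addRight i.succ = finRotate (n + 1) * Equiv.addRight i.castSucc := by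
      ext x
      rw [Equiv.Perm.mul_apply, Equiv.coe_addRight, Equiv.coe_addRight, finRotate_apply,
        ← Fin.coeSucc_eq_succ, add_assoc]
    rw [this]
    exact Subgroup.mul_mem _ (Subgroup.subset_closure (by simp)) ih

theorem mem_naturalDihedral_of_step_one {n : ℕ} (π : Equiv.Perm (Fin (n + 1)))
    (h : ∀ i : Fin n, π i.succ = π i.castSucc + 1) : π ∈ naturalDihedral (n + 1) := by
  have key : ∀ x, π x = x + π 0 := by
    intro x
    induction x using Fin.induction with
    | zero => simp
    | succ i ih => rw [h, ih, ← Fin.coeSucc_eq_succ]; abel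
  rw [show π = Equiv.addRight (π 0) from Equiv.ext key]
  exact addRight_mem_naturalDihedral _

theorem step_const_of_step {n : ℕ} (π : Equiv.Perm (Fin (n + 1)))
    (h : ∀ i : Fin n, π i.succ = π i.castSucc + 1 ∨ π i.succ = π i.castSucc - 1) :
    (∀ i : Fin n, π i.succ = π i.castSucc + 1) ∨ ∀ i : Fin n, π i.succ = π i.castSucc - 1 := by
  cases n with
  | zero => exact Or.inl fun i => i.elim0
  | succ n =>
    have back : ∀ i : Fin n, π i.succ.succ ≠ π i.castSucc.castSucc := fun i e => by
      have := congrArg Fin.val (π.injective e)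
      simp only [Fin.val_succ, Fin.val_castSucc] at this
      omega
    refine (h 0).imp (fun h0 i => ?_) fun h0 i => ?_
    · induction i using Fin.induction with
      | zero => exact h0
      | succ i ih =>
        refine (h i.succ).resolve_right fun e => back i ?_
        rw [e, ← Fin.succ_castSucc, ih, add_sub_cancel_right]
    · induction i using Fin.induction with
      | zero => exact h0
      | succ i ih =>
        refine (h i.succ).resolve_left fun e => back i ?_
        rw [e, ← Fin.succ_castSucc, ih, sub_add_cancel]

theorem mem_naturalDihedral_of_step {n : ℕ} (π : Equiv.Perm (Fin (n + 1)))
    (h : ∀ i : Fin n, π i.succ = π i.castSucc + 1 ∨ π i.succ = π i.castSucc - 1) :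
    π ∈ naturalDihedral (n + 1) := by
  rcases step_const_of_step π h with h | h
  · exact mem_naturalDihedral_of_step_one π h
  · have hδ : descPerm (n + 1) ∈ naturalDihedral (n + 1) := Subgroup.subset_closure (by simp)
    refine (Subgroup.mul_mem_cancel_left _ hδ).mp (mem_naturalDihedral_of_step_one _ fun i => ?_)
    have hrev : ∀ x : Fin (n + 1), descPerm (n + 1) x = Fin.last n - x := fun x =>
      (Fin.last_sub x).symm
    rw [Equiv.Perm.mul_apply, Equiv.Perm.mul_apply, h, hrev, hrev]
    abel

theorem alternating_le_of_comp_not_le_dihedral {n : ℕ} (hn : 0 < n)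
    (G : Subgroup (Equiv.Perm (Fin n))) (hζ : finRotate n ∈ G)
    (hC : ¬ Compn (n + 1) (G : Set (Equiv.Perm (Fin n))) ⊆
      (naturalDihedral (n + 1) : Set (Equiv.Perm (Fin (n + 1))))) :
    alternatingGroup (Fin n) ≤ G := by
  obtain ⟨π, hπ, hπD⟩ := Set.not_subset.mp hC
  obtain ⟨i, hi⟩ : ∃ i : Fin n, ¬ (π i.succ = π i.castSucc + 1 ∨ π i.succ = π i.castSucc - 1) := by
    by_contra! hcon
    exact hπD (mem_naturalDihedral_of_step π hcon)
  have hmem : ∀ j, deletePattern π j ∈ G := fun j => hπ _ (isPattern_deletePattern π j)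
  have hσ := G.mul_mem (hmem i.succ) (G.inv_mem (hmem i.castSucc))
  have hhole := isHoleSwap_deletePattern π i
  have hne : π i.castSucc ≠ π i.succ := fun e => (Fin.castSucc_lt_succ).ne (π.injective e)
  generalize π i.castSucc = a at *
  generalize π i.succ = b at *
  rw [not_or, eq_sub_iff_add_eq] at hi
  have hstep : ∀ x y : Fin (n + 1), x < y → y ≠ x + 1 → y + 1 ≠ x →
      (x : ℕ) + 2 ≤ y ∧ (y : ℕ) < x + n := by
    intro x y hxy h₁ h₂
    rw [ne_eq, Fin.ext_iff, Fin.val_add_one] at h₁ h₂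
    simp only [Fin.ext_iff, Fin.lt_def, Fin.val_last] at *
    split_ifs at h₁ h₂ <;> omega
  rcases lt_or_gt_of_ne hne with hlt | hlt
  · obtain ⟨h₁, h₂⟩ := hstep a b hlt hi.1 hi.2
    exact alternatingGroup_le_of_isHoleSwap G hζ hσ hhole h₁ h₂
  · obtain ⟨h₁, h₂⟩ := hstep b a hlt (Ne.symm hi.2) (Ne.symm hi.1)
    exact alternatingGroup_le_of_isHoleSwap G hζ (G.inv_mem hσ) hhole.inv h₁ h₂
end
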